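/- arXiv:2504.04300 — 2 statements merged into one kernel-verified Lean document; each statement's English description precedes it below -/
import Mathlib

section
/- Let (Ω, F, (F_t)_{t∈[0,T]}, P) be a filtered probability space with T > 0, let N ≥ 1, and for n = 1, …, N let γ_n > 0 and ξ_n ∈ ℝ. Let μ, σ, B, and φ_1, …, φ_N be real-valued adapted processes with continuous sample paths that are uniformly bounded. Suppose that for every t ∈ [0,T], Σ_{n=1}^N E[ ∫_t^T ( μ_u − γ_n σ_u (φ_{n,u} σ_u + ξ_n B_u) ) du | F_t ] = 0 almost surely. Then for every t ∈ [0,T], μ_t = (1/N) Σ_{n=1}^N γ_n σ_t (σ_t φ_{n,t} + ξ_n B_t) almost surely. -/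
open MeasureTheory Filter Set
open scoped ENNReal NNReal BigOperators

theorem key_aux
    {Ω : Type*} {m0 : MeasurableSpace Ω} {P : Measure Ω} [IsProbabilityMeasure P]
    {T : ℝ} (hT : 0 < T) (ℱ : Filtration ℝ m0) (g : ℝ → Ω → ℝ)
    (had : ∀ t, Measurable[ℱ t] (g t)) (hcont : ∀ ω, Continuous fun t => g t ω)
    (K : ℝ) (hK : ∀ t ω, |g t ω| ≤ K)
    (h : ∀ t ∈ Set.Icc (0 : ℝ) T, P[(fun ω => ∫ u in t..T, g u ω) | ℱ t] =ᵐ[P] 0) :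
    ∀ t ∈ Set.Icc (0 : ℝ) T, ∀ᵐ ω ∂P, g t ω = 0 := by
  have hK0 : 0 ≤ K := by
    obtain ⟨ω⟩ : Nonempty Ω := P.nonempty_of_neZero
    exact (abs_nonneg _).trans (hK 0 ω)
  have hm : ∀ t, Measurable (g t) := fun t => (had t).mono (ℱ.le t) le_rfl
  have hjm : Measurable (Function.uncurry fun ω t => g t ω) := by
    have := measurable_uncurry_of_continuous_of_measurable (u := g) hcont hm
    exact this.comp measurable_swap
  have hIm : ∀ a b : ℝ, StronglyMeasurable (fun ω => ∫ u in a..b, g u ω) := by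
    intro a b
    simp only [intervalIntegral]
    exact (hjm.stronglyMeasurable.integral_prod_right (ν := volume.restrict (Ioc a b))).sub
      (hjm.stronglyMeasurable.integral_prod_right (ν := volume.restrict (Ioc b a)))
  have hIb : ∀ a b : ℝ, ∀ ω, ‖∫ u in a..b, g u ω‖ ≤ K * |b - a| := fun a b ω =>
    intervalIntegral.norm_integral_le_of_norm_le_const (fun x _ => hK x ω)
  have hInt : ∀ a b : ℝ, Integrable (fun ω => ∫ u in a..b, g u ω) P := fun a b =>
    Integrable.of_bound (hIm a b).aestronglyMeasurable (K * |b - a|)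
      (Eventually.of_forall (hIb a b))
  have hgi : ∀ t, Integrable (g t) P := fun t =>
    Integrable.of_bound (hm t).aestronglyMeasurable K (Eventually.of_forall (hK t))
  have hz : ∀ t ∈ Set.Icc (0 : ℝ) T, ∀ A, MeasurableSet[ℱ t] A →
      ∫ ω in A, (∫ u in t..T, g u ω) ∂P = 0 := by
    intro t ht A hA
    rw [← setIntegral_condExp (ℱ.le t) (hInt t T) hA]
    rw [setIntegral_congr_ae (g := fun _ => (0 : ℝ)) (ℱ.le t A hA)]
    · simp
    · filter_upwards [h t ht] with ω hω _ using hω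
  have hlt : ∀ s ∈ Set.Ico (0 : ℝ) T, ∀ᵐ ω ∂P, g s ω = 0 := by
    intro s hs
    have hsub : ∀ A, MeasurableSet[ℱ s] A → ∫ ω in A, g s ω ∂P = 0 := by
      intro A hA
      have hev : ∀ᶠ t in nhdsWithin s (Ioi s),
          ∫ ω in A, (t - s)⁻¹ * (∫ u in s..t, g u ω) ∂P = 0 := by
        filter_upwards [Ioo_mem_nhdsGT hs.2] with t ht
        have e : ∀ ω, ∫ u in s..t, g u ω = (∫ u in s..T, g u ω) - ∫ u in t..T, g u ω := by
          intro ω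
          rw [eq_sub_iff_add_eq]
          exact intervalIntegral.integral_add_adjacent_intervals
            ((hcont ω).intervalIntegrable _ _) ((hcont ω).intervalIntegrable _ _)
        rw [integral_const_mul]
        simp_rw [e]
        rw [integral_sub (hInt s T).integrableOn (hInt t T).integrableOn,
          hz s ⟨hs.1, hs.2.le⟩ A hA,
          hz t ⟨hs.1.trans ht.1.le, ht.2.le⟩ A (ℱ.mono ht.1.le A hA)]
        simp
      have hlim : Tendsto (fun t => ∫ ω in A, (t - s)⁻¹ * (∫ u in s..t, g u ω) ∂P)
          (nhdsWithin s (Ioi s)) (nhds (∫ ω in A, g s ω ∂P)) := by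
        refine tendsto_integral_filter_of_dominated_convergence (fun _ => K) ?_ ?_ ?_ ?_
        · exact Eventually.of_forall fun t => ((hIm s t).const_mul _).aestronglyMeasurable
        · filter_upwards [self_mem_nhdsWithin] with t ht
          refine Eventually.of_forall fun ω => ?_
          have hts : 0 < t - s := sub_pos.2 ht
          rw [norm_mul, norm_inv, Real.norm_of_nonneg hts.le, inv_mul_le_iff₀ hts]
          have := hIb s t ω
          rw [abs_of_pos hts] at this
          linarith
        · exact integrable_const _
        · refine Eventually.of_forall fun ω => ?_
          have hd : HasDerivAt (fun t => ∫ u in s..t, g u ω) (g s ω) s :=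
            intervalIntegral.integral_hasDerivAt_right ((hcont ω).intervalIntegrable _ _)
              ((hcont ω).stronglyMeasurableAtFilter _ _) (hcont ω).continuousAt
          have h2 := (hasDerivAt_iff_tendsto_slope.1 hd).mono_left
            (nhdsWithin_mono s (fun x (hx : s < x) => ne_of_gt hx))
          refine h2.congr fun t => ?_
          simp [slope]
      exact tendsto_nhds_unique hlim (tendsto_const_nhds.congr' (hev.mono fun t ht => ht.symm))
    have := ae_eq_of_forall_setIntegral_eq_of_sigmaFinite' (μ := P) (ℱ.le s) (f := g s)
      (g := fun _ => (0 : ℝ)) (fun A _ _ => (hgi s).integrableOn)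
      (fun A _ _ => (integrable_zero _ _ _).integrableOn)
      (fun A hA _ => by simpa using hsub A hA)
      (had s).stronglyMeasurable.aestronglyMeasurable
      stronglyMeasurable_const.aestronglyMeasurable
    exact this
  intro t ht
  rcases ht.2.lt_or_eq with h1 | rfl
  · exact hlt t ⟨ht.1, h1⟩
  · have hseq : ∀ k : ℕ, ∀ᵐ ω ∂P, g (t - t / ((k : ℝ) + 1)) ω = 0 := by
      intro k
      apply hlt
      have hk : (0 : ℝ) < (k : ℝ) + 1 := by positivity
      have h3 : t / ((k : ℝ) + 1) ≤ t := div_le_self hT.le (by linarith [k.cast_nonneg (α := ℝ)])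
      have h4 : 0 < t / ((k : ℝ) + 1) := by positivity
      constructor <;> linarith
    filter_upwards [ae_all_iff.2 hseq] with ω hω
    have hl : Tendsto (fun k : ℕ => t - t / ((k : ℝ) + 1)) atTop (nhds t) := by
      have := (tendsto_one_div_add_atTop_nhds_zero_nat (𝕜 := ℝ)).const_mul t
      have := this.const_sub t
      simpa [div_eq_mul_inv] using this
    have h5 := ((hcont ω).tendsto t).comp hl
    refine tendsto_nhds_unique h5 (tendsto_const_nhds.congr fun k => (hω k).symm)

/-- Closed-form equilibrium excess return under quadratic trading costs: if the
market-clearing condition `Σ_n E[∫_t^T (μ_u − γ_n σ_u(φ_{n,u}σ_u + ξ_n B_u)) du | F_t] = 0`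
holds a.s. for every `t ∈ [0,T]`, then
`μ_t = (1/N) Σ_n γ_n σ_t (σ_t φ_{n,t} + ξ_n B_t)` a.s. for every `t ∈ [0,T]`. -/
theorem stmt_9
    {Ω : Type*} {m0 : MeasurableSpace Ω} {P : Measure Ω} [IsProbabilityMeasure P]
    {T : ℝ} (hT : 0 < T)
    (ℱ : Filtration ℝ m0)
    (N : ℕ) (hN : 1 ≤ N)
    (γ ξ : Fin N → ℝ) (hγ : ∀ n, 0 < γ n)
    (μ σ B : ℝ → Ω → ℝ) (φ : Fin N → ℝ → Ω → ℝ)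
    (hμad : Adapted ℱ μ) (hσad : Adapted ℱ σ) (hBad : Adapted ℱ B)
    (hφad : ∀ n, Adapted ℱ (φ n))
    (hμcont : ∀ ω, Continuous fun t => μ t ω)
    (hσcont : ∀ ω, Continuous fun t => σ t ω)
    (hBcont : ∀ ω, Continuous fun t => B t ω)
    (hφcont : ∀ n ω, Continuous fun t => φ n t ω)
    (C : ℝ)
    (hbdd : ∀ t ω, |μ t ω| ≤ C ∧ |σ t ω| ≤ C ∧ |B t ω| ≤ C ∧ ∀ n, |φ n t ω| ≤ C)
    (hclear : ∀ t ∈ Set.Icc (0 : ℝ) T, ∀ᵐ ω ∂P,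
      ∑ n : Fin N,
        (P[(fun ω' => ∫ u in t..T,
            (μ u ω' - γ n * σ u ω' * (φ n u ω' * σ u ω' + ξ n * B u ω'))) | ℱ t]) ω = 0) :
    ∀ t ∈ Set.Icc (0 : ℝ) T, ∀ᵐ ω ∂P,
      μ t ω = (1 / (N : ℝ)) *
        ∑ n : Fin N, γ n * σ t ω * (σ t ω * φ n t ω + ξ n * B t ω) := by
  have hf_m : ∀ n t, Measurable[ℱ t]
      (fun ω => μ t ω - γ n * σ t ω * (φ n t ω * σ t ω + ξ n * B t ω)) := by
    intro n t
    have h1 : Measurable[ℱ t] (μ t) := hμad t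
    have h2 : Measurable[ℱ t] (σ t) := hσad t
    have h3 : Measurable[ℱ t] (B t) := hBad t
    have h4 : Measurable[ℱ t] (φ n t) := hφad n t
    exact h1.sub ((h2.const_mul _).mul ((h4.mul h2).add (h3.const_mul _)))
  have hf_c : ∀ n ω, Continuous
      (fun t => μ t ω - γ n * σ t ω * (φ n t ω * σ t ω + ξ n * B t ω)) := by
    intro n ω
    have h1 := hμcont ω
    have h2 := hσcont ω
    have h3 := hBcont ω
    have h4 := hφcont n ω
    fun_prop
  have hf_b : ∀ n t ω, |μ t ω - γ n * σ t ω * (φ n t ω * σ t ω + ξ n * B t ω)|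
      ≤ C + |γ n| * C * (C * C + |ξ n| * C) := by
    intro n t ω
    obtain ⟨h1, h2, h3, h4⟩ := hbdd t ω
    have h4 := h4 n
    have hC : 0 ≤ C := (abs_nonneg _).trans h1
    refine (abs_sub _ _).trans (add_le_add h1 ?_)
    rw [abs_mul, abs_mul]
    refine mul_le_mul (by gcongr) ((abs_add_le _ _).trans ?_) (abs_nonneg _) (by positivity)
    rw [abs_mul, abs_mul]
    gcongr
  set f : Fin N → ℝ → Ω → ℝ := fun n t ω =>
    μ t ω - γ n * σ t ω * (φ n t ω * σ t ω + ξ n * B t ω) with hf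
  have hfi : ∀ n t, Integrable (fun ω => ∫ u in t..T, f n u ω) P := by
    intro n t
    have hjm : Measurable (Function.uncurry fun ω t => f n t ω) :=
      (measurable_uncurry_of_continuous_of_measurable (u := f n) (hf_c n)
        (fun t => (hf_m n t).mono (ℱ.le t) le_rfl)).comp measurable_swap
    refine Integrable.of_bound (C := (C + |γ n| * C * (C * C + |ξ n| * C)) * |T - t|) ?_
      (Eventually.of_forall fun ω =>
        intervalIntegral.norm_integral_le_of_norm_le_const (fun x _ => hf_b n x ω))
    simp only [intervalIntegral]
    exact ((hjm.stronglyMeasurable.integral_prod_right (ν := volume.restrict (Ioc t T))).sub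
      (hjm.stronglyMeasurable.integral_prod_right
        (ν := volume.restrict (Ioc T t)))).aestronglyMeasurable
  have main := key_aux (P := P) hT ℱ (fun t ω => ∑ n, f n t ω)
    (fun t => Finset.measurable_fun_sum _ fun n _ => hf_m n t)
    (fun ω => continuous_finsetSum _ fun n _ => hf_c n ω)
    (∑ n, (C + |γ n| * C * (C * C + |ξ n| * C)))
    (fun t ω => (Finset.abs_sum_le_sum_abs _ _).trans (Finset.sum_le_sum fun n _ => hf_b n t ω))
    (by
      intro t ht
      have e : (fun ω => ∫ u in t..T, ∑ n, f n u ω)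
          = ∑ n, fun ω => ∫ u in t..T, f n u ω := by
        ext ω
        rw [Finset.sum_apply]
        exact intervalIntegral.integral_finsetSum
          (fun n _ => (hf_c n ω).intervalIntegrable _ _)
      rw [e]
      refine (condExp_finsetSum (fun n _ => hfi n t) (ℱ t)).trans ?_
      filter_upwards [hclear t ht] with ω hω
      rw [Finset.sum_apply]
      exact hω)
  intro t ht
  filter_upwards [main t ht] with ω hω
  have hN' : (N : ℝ) ≠ 0 := by
    have : 0 < N := hN
    positivity
  simp only [hf, Finset.sum_sub_distrib, Finset.sum_const, Finset.card_univ, Fintype.card_fin,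
    nsmul_eq_mul] at hω
  rw [one_div, eq_inv_mul_iff_mul_eq₀ hN', sub_eq_zero.1 hω]
  exact Finset.sum_congr rfl fun n _ => by ring
end

section
/- Let (Ω, F, (F_t)_{t∈[0,T]}, P) be a filtered probability space with T > 0, let λ > 0 and q ∈ (1,2], and define ψ : ℝ → ℝ by ψ(a) := λ · sign(a) · |a|^{q−1} (with ψ(0) = 0). For n = 1, 2 let γ_n > 0 and ξ_n ∈ ℝ, and let μ, σ, B, φ_1, φ_2, a_1, a_2 be real-valued adapted processes with continuous sample paths that are uniformly bounded. Suppose that (i) a_{1,t} + a_{2,t} = 0 for every t almost surely, and (ii) for n = 1, 2 and every t ∈ [0,T], E[ ∫_t^T ( μ_u − γ_n σ_u (φ_{n,u} σ_u + ξ_n B_u) ) du | F_t ] = ψ(a_{n,t}) almost surely. Then for every t ∈ [0,T], μ_t = (1/2)( γ_1 σ_t (σ_t φ_{1,t} + ξ_1 B_t) + γ_2 σ_t (σ_t φ_{2,t} + ξ_2 B_t) ) almost surely. -/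
open MeasureTheory Filter Set
open scoped ENNReal NNReal

lemma meas_int {Ω : Type*} {m0 : MeasurableSpace Ω} 
    (h : ℝ → Ω → ℝ) (hm : ∀ t, Measurable (h t))
    (hc : ∀ ω, Continuous fun t => h t ω) (s t : ℝ) :
    StronglyMeasurable (fun ω => ∫ u in s..t, h u ω) := by
  have hu : Measurable (Function.uncurry h) :=
    measurable_uncurry_of_continuous_of_measurable (u := h) hc hm
  have hu2 : StronglyMeasurable (Function.uncurry fun ω u => h u ω) :=
    (hu.comp measurable_swap).stronglyMeasurable
  simp only [intervalIntegral]
  exact hu2.integral_prod_right.sub hu2.integral_prod_right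

lemma bd_int {Ω : Type*} (h : ℝ → Ω → ℝ) (K : ℝ) (hb : ∀ t ω, |h t ω| ≤ K) (s t : ℝ) (ω : Ω) :
    ‖∫ u in s..t, h u ω‖ ≤ K * |t - s| :=
  intervalIntegral.norm_integral_le_of_norm_le_const (fun u _ => hb u ω)

lemma int_int {Ω : Type*} {m0 : MeasurableSpace Ω} {P : Measure Ω} [IsProbabilityMeasure P]
    (h : ℝ → Ω → ℝ) (hm : ∀ t, Measurable (h t))
    (hc : ∀ ω, Continuous fun t => h t ω) (K : ℝ) (hb : ∀ t ω, |h t ω| ≤ K) (s t : ℝ) :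
    Integrable (fun ω => ∫ u in s..t, h u ω) P :=
  Integrable.of_bound (meas_int h hm hc s t).aestronglyMeasurable (K * |t - s|)
    (ae_of_all _ (bd_int h K hb s t))

lemma key_lt {Ω : Type*} {m0 : MeasurableSpace Ω} {P : Measure Ω} [IsProbabilityMeasure P]
    {T : ℝ} (ℱ : Filtration ℝ m0) (h : ℝ → Ω → ℝ) (hm : ∀ t, Measurable[ℱ t] (h t))
    (hc : ∀ ω, Continuous fun t => h t ω) (K : ℝ) (hb : ∀ t ω, |h t ω| ≤ K)
    (hE : ∀ t ∈ Set.Icc (0 : ℝ) T, P[(fun ω => ∫ u in t..T, h u ω) | ℱ t] =ᵐ[P] 0)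
    (s : ℝ) (hs0 : 0 ≤ s) (hsT : s < T) : ∀ᵐ ω ∂P, h s ω = 0 := by
  have hm' : ∀ t, Measurable (h t) := fun t => (hm t).mono (ℱ.le t) le_rfl
  have hint := int_int (P := P) h hm' hc K hb
  have hstep : ∀ t ∈ Set.Icc s T, P[(fun ω => ∫ u in s..t, h u ω) | ℱ s] =ᵐ[P] 0 := by
    intro t ht
    have e : (fun ω => ∫ u in s..t, h u ω)
        = (fun ω => ∫ u in s..T, h u ω) - (fun ω => ∫ u in t..T, h u ω) := by
      funext ω
      have := intervalIntegral.integral_add_adjacent_intervals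
        ((hc ω).intervalIntegrable (μ := volume) s t) ((hc ω).intervalIntegrable t T)
      simp only [Pi.sub_apply]
      linarith
    rw [e]
    have h1 := condExp_sub (hint s T) (hint t T) (ℱ s)
    have h2 := condExp_condExp_of_le (μ := P) (f := fun ω => ∫ u in t..T, h u ω)
      (ℱ.mono ht.1) (ℱ.le t)
    have h3 := condExp_congr_ae (m := ℱ s) (hE t ⟨hs0.trans ht.1, ht.2⟩)
    rw [condExp_zero] at h3
    filter_upwards [h1, h2, h3, hE s ⟨hs0, hsT.le⟩] with ω w1 w2 w3 w4
    rw [w1, Pi.sub_apply, w4, ← w2, w3]; simp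
  let d : ℕ → ℝ := fun n => (T - s) * (1 / ((n : ℝ) + 1))
  have hd0 : ∀ n, 0 < d n := fun n => mul_pos (sub_pos.2 hsT) (by positivity)
  have hd1 : ∀ n, d n ≤ T - s := fun n => by
    have : 1 / ((n : ℝ) + 1) ≤ 1 := by
      rw [div_le_one (by positivity)]; linarith [(Nat.cast_nonneg n : (0:ℝ) ≤ n)]
    exact mul_le_of_le_one_right (sub_pos.2 hsT).le this
  have hdt : Tendsto d atTop (nhds 0) := by
    simpa [d] using (tendsto_one_div_add_atTop_nhds_zero_nat (𝕜 := ℝ)).const_mul (T - s)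
  let fs : ℕ → Ω → ℝ := fun n => (d n)⁻¹ • fun ω => ∫ u in s..(s + d n), h u ω
  have hK : ∀ n ω, ‖fs n ω‖ ≤ K := by
    intro n ω
    have := bd_int h K hb s (s + d n) ω
    rw [add_sub_cancel_left, abs_of_pos (hd0 n)] at this
    simp only [fs, Pi.smul_apply, norm_smul, norm_inv, Real.norm_of_nonneg (hd0 n).le]
    rw [inv_mul_le_iff₀ (hd0 n)]
    linarith
  have hlim : ∀ ω, Tendsto (fun n => fs n ω) atTop (nhds (h s ω)) := by
    intro ω
    have hder : HasDerivAt (fun t => ∫ u in s..t, h u ω) (h s ω) s :=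
      ((hc ω).integral_hasStrictDerivAt s s).hasDerivAt
    have ht : Tendsto (fun n => s + d n) atTop (nhdsWithin s {s}ᶜ) := by
      refine tendsto_nhdsWithin_iff.2 ⟨by simpa using hdt.const_add s, ?_⟩
      refine Eventually.of_forall fun n => ?_
      have := hd0 n
      simp [this.ne']
    have := hder.tendsto_slope.comp ht
    refine this.congr fun n => ?_
    simp [slope, fs]
  have hfsint : ∀ n, Integrable (fs n) P := fun n => (hint s (s + d n)).smul _
  have := tendsto_condExp_unique (m := ℱ s) (μ := P) fs (fun _ => 0) (h s) 0 hfsint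
    (fun _ => integrable_zero _ _ _) (ae_of_all _ hlim) (ae_of_all _ fun ω => tendsto_const_nhds)
    (fun _ => K) (integrable_const _) (fun _ => 0) (integrable_zero _ _ _)
    (fun n => ae_of_all _ (hK n)) (fun n => ae_of_all _ (by simp)) (fun n => by
      rw [condExp_zero]
      have h1 := condExp_smul (μ := P) (d n)⁻¹ (fun ω => ∫ u in s..(s + d n), h u ω) (ℱ s)
      have h2 := hstep (s + d n) ⟨by linarith [hd0 n], by linarith [hd1 n]⟩
      filter_upwards [h1, h2] with ω w1 w2
      simp only [fs]
      rw [w1, Pi.smul_apply, w2]; simp)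
  rw [condExp_zero, condExp_of_stronglyMeasurable (ℱ.le s) (hm s).stronglyMeasurable
    (Integrable.of_bound (hm' s).aestronglyMeasurable K (ae_of_all _ (hb s)))] at this
  exact this

lemma key {Ω : Type*} {m0 : MeasurableSpace Ω} {P : Measure Ω} [IsProbabilityMeasure P]
    {T : ℝ} (hT : 0 < T) (ℱ : Filtration ℝ m0) (h : ℝ → Ω → ℝ) (hm : ∀ t, Measurable[ℱ t] (h t))
    (hc : ∀ ω, Continuous fun t => h t ω) (K : ℝ) (hb : ∀ t ω, |h t ω| ≤ K)
    (hE : ∀ t ∈ Set.Icc (0 : ℝ) T, P[(fun ω => ∫ u in t..T, h u ω) | ℱ t] =ᵐ[P] 0)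
    (s : ℝ) (hs : s ∈ Set.Icc (0 : ℝ) T) : ∀ᵐ ω ∂P, h s ω = 0 := by
  have hlt := key_lt ℱ h hm hc K hb hE
  rcases hs.2.lt_or_eq with h1 | rfl
  · exact hlt s hs.1 h1
  have hd : ∀ n : ℕ, 0 < s * (1 / ((n : ℝ) + 1)) := fun n => by positivity
  have hd1 : ∀ n : ℕ, s * (1 / ((n : ℝ) + 1)) ≤ s := fun n => by
    have : 1 / ((n : ℝ) + 1) ≤ 1 := by
      rw [div_le_one (by positivity)]; linarith [(Nat.cast_nonneg n : (0:ℝ) ≤ n)]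
    exact mul_le_of_le_one_right hT.le this
  have hall : ∀ᵐ ω ∂P, ∀ n : ℕ, h (s - s * (1 / ((n : ℝ) + 1))) ω = 0 :=
    ae_all_iff.2 fun n => hlt _ (by linarith [hd1 n]) (by linarith [hd n])
  filter_upwards [hall] with ω hω
  have ht : Tendsto (fun n : ℕ => s - s * (1 / ((n : ℝ) + 1))) atTop (nhds s) := by
    simpa using ((tendsto_one_div_add_atTop_nhds_zero_nat (𝕜 := ℝ)).const_mul s).const_sub s
  have := ((hc ω).tendsto s).comp ht
  refine tendsto_nhds_unique this ?_
  simp [Function.comp_def, -one_div, hω]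

/-- Closed-form equilibrium excess return in a two-agent market with superlinear power
trading costs: if the trading rates offset (`a₁ + a₂ = 0`) and each agent's marginal
trading cost satisfies `E[∫_t^T (μ_u − γ_n σ_u(φ_{n,u}σ_u + ξ_n B_u)) du | F_t] = ψ(a_{n,t})`
with `ψ(a) = λ·sign(a)·|a|^{q−1}`, then
`μ_t = ½(γ₁σ_t(σ_tφ_{1,t} + ξ₁B_t) + γ₂σ_t(σ_tφ_{2,t} + ξ₂B_t))` a.s. for `t ∈ [0,T]`. -/
theorem stmt_10
    {Ω : Type*} {m0 : MeasurableSpace Ω} {P : Measure Ω} [IsProbabilityMeasure P]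
    {T : ℝ} (hT : 0 < T)
    (lam q : ℝ) (hlam : 0 < lam) (hq1 : 1 < q) (hq2 : q ≤ 2)
    (ψ : ℝ → ℝ) (hψ : ∀ a : ℝ, ψ a = lam * Real.sign a * |a| ^ (q - 1))
    (ℱ : Filtration ℝ m0)
    (γ₁ γ₂ ξ₁ ξ₂ : ℝ) (hγ₁ : 0 < γ₁) (hγ₂ : 0 < γ₂)
    (μ σ B φ₁ φ₂ a₁ a₂ : ℝ → Ω → ℝ)
    (hμad : Adapted ℱ μ) (hσad : Adapted ℱ σ) (hBad : Adapted ℱ B)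
    (hφ₁ad : Adapted ℱ φ₁) (hφ₂ad : Adapted ℱ φ₂)
    (ha₁ad : Adapted ℱ a₁) (ha₂ad : Adapted ℱ a₂)
    (hμcont : ∀ ω, Continuous fun t => μ t ω)
    (hσcont : ∀ ω, Continuous fun t => σ t ω)
    (hBcont : ∀ ω, Continuous fun t => B t ω)
    (hφ₁cont : ∀ ω, Continuous fun t => φ₁ t ω)
    (hφ₂cont : ∀ ω, Continuous fun t => φ₂ t ω)
    (ha₁cont : ∀ ω, Continuous fun t => a₁ t ω)
    (ha₂cont : ∀ ω, Continuous fun t => a₂ t ω)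
    (C : ℝ)
    (hbdd : ∀ t ω, |μ t ω| ≤ C ∧ |σ t ω| ≤ C ∧ |B t ω| ≤ C ∧
      |φ₁ t ω| ≤ C ∧ |φ₂ t ω| ≤ C ∧ |a₁ t ω| ≤ C ∧ |a₂ t ω| ≤ C)
    (hclearing : ∀ t ∈ Set.Icc (0 : ℝ) T, ∀ᵐ ω ∂P, a₁ t ω + a₂ t ω = 0)
    (hY₁ : ∀ t ∈ Set.Icc (0 : ℝ) T,
      (P[(fun ω' => ∫ u in t..T,
          (μ u ω' - γ₁ * σ u ω' * (φ₁ u ω' * σ u ω' + ξ₁ * B u ω'))) | ℱ t])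
        =ᵐ[P] fun ω => ψ (a₁ t ω))
    (hY₂ : ∀ t ∈ Set.Icc (0 : ℝ) T,
      (P[(fun ω' => ∫ u in t..T,
          (μ u ω' - γ₂ * σ u ω' * (φ₂ u ω' * σ u ω' + ξ₂ * B u ω'))) | ℱ t])
        =ᵐ[P] fun ω => ψ (a₂ t ω)) :
    ∀ t ∈ Set.Icc (0 : ℝ) T, ∀ᵐ ω ∂P,
      μ t ω = (1 / 2) * (γ₁ * σ t ω * (σ t ω * φ₁ t ω + ξ₁ * B t ω) +
        γ₂ * σ t ω * (σ t ω * φ₂ t ω + ξ₂ * B t ω)) := by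
  have hCn : ∀ ω : Ω, 0 ≤ C := fun ω => (abs_nonneg _).trans (hbdd 0 ω).1
  have aux : ∀ (γ ξ : ℝ) (φ : ℝ → Ω → ℝ), 0 < γ → (∀ t ω, |φ t ω| ≤ C) → ∀ t ω,
      |μ t ω - γ * σ t ω * (φ t ω * σ t ω + ξ * B t ω)| ≤ C + γ * C * (C * C + |ξ| * C) := by
    intro γ ξ φ hγ hφ t ω
    have hC := hCn ω
    obtain ⟨b1, b2, b3, -⟩ := hbdd t ω
    have b4 := hφ t ω
    calc |μ t ω - γ * σ t ω * (φ t ω * σ t ω + ξ * B t ω)|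
        ≤ |μ t ω| + |γ * σ t ω * (φ t ω * σ t ω + ξ * B t ω)| := abs_sub _ _
      _ ≤ |μ t ω| + γ * |σ t ω| * (|φ t ω| * |σ t ω| + |ξ| * |B t ω|) := by
          rw [abs_mul, abs_mul, abs_of_pos hγ, ← abs_mul, ← abs_mul]
          gcongr
          exact abs_add_le _ _
      _ ≤ _ := by gcongr
  let g₁ : ℝ → Ω → ℝ := fun u ω => μ u ω - γ₁ * σ u ω * (φ₁ u ω * σ u ω + ξ₁ * B u ω)
  let g₂ : ℝ → Ω → ℝ := fun u ω => μ u ω - γ₂ * σ u ω * (φ₂ u ω * σ u ω + ξ₂ * B u ω)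
  have b₁ : ∀ t ω, |g₁ t ω| ≤ _ := aux γ₁ ξ₁ φ₁ hγ₁ (fun t ω => (hbdd t ω).2.2.2.1)
  have b₂ : ∀ t ω, |g₂ t ω| ≤ _ := aux γ₂ ξ₂ φ₂ hγ₂ (fun t ω => (hbdd t ω).2.2.2.2.1)
  have m₁ : ∀ t, Measurable[ℱ t] (g₁ t) := fun t =>
    (hμad t).sub (((hσad t).const_mul γ₁).mul (((hφ₁ad t).mul (hσad t)).add ((hBad t).const_mul ξ₁)))
  have m₂ : ∀ t, Measurable[ℱ t] (g₂ t) := fun t =>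
    (hμad t).sub (((hσad t).const_mul γ₂).mul (((hφ₂ad t).mul (hσad t)).add ((hBad t).const_mul ξ₂)))
  have c₁ : ∀ ω, Continuous fun t => g₁ t ω := fun ω =>
    (hμcont ω).sub ((continuous_const.mul (hσcont ω)).mul
      (((hφ₁cont ω).mul (hσcont ω)).add (continuous_const.mul (hBcont ω))))
  have c₂ : ∀ ω, Continuous fun t => g₂ t ω := fun ω =>
    (hμcont ω).sub ((continuous_const.mul (hσcont ω)).mul
      (((hφ₂cont ω).mul (hσcont ω)).add (continuous_const.mul (hBcont ω))))
  have hodd : ∀ a, ψ (-a) = - ψ a := by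
    intro a
    rw [hψ, hψ, Real.sign_neg, abs_neg]; ring
  have hk := key (P := P) hT ℱ (fun u ω => g₁ u ω + g₂ u ω) (fun t => (m₁ t).add (m₂ t))
    (fun ω => (c₁ ω).add (c₂ ω)) _
    (fun t ω => (abs_add_le _ _).trans (add_le_add (b₁ t ω) (b₂ t ω))) (by
      intro t ht
      have e : (fun ω => ∫ u in t..T, (g₁ u ω + g₂ u ω))
          = (fun ω => ∫ u in t..T, g₁ u ω) + (fun ω => ∫ u in t..T, g₂ u ω) := by
        funext ω
        exact intervalIntegral.integral_add ((c₁ ω).intervalIntegrable _ _)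
          ((c₂ ω).intervalIntegrable _ _)
      rw [e]
      have h1 := condExp_add (μ := P)
        (int_int g₁ (fun t => (m₁ t).mono (ℱ.le t) le_rfl) c₁ _ b₁ t T)
        (int_int g₂ (fun t => (m₂ t).mono (ℱ.le t) le_rfl) c₂ _ b₂ t T) (ℱ t)
      filter_upwards [h1, hY₁ t ht, hY₂ t ht, hclearing t ht] with ω w1 w2 w3 w4
      rw [w1, Pi.add_apply, w2, w3, show a₂ t ω = - a₁ t ω by linarith, hodd]
      simp)
  intro t ht
  filter_upwards [hk t ht] with ω hω
  simp only [g₁, g₂] at hω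
  linarith
end
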